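/- Let 0 ≤ α < ω₁ and let A be a subset of the α'th functionally multiplicative class of a topological space X. Then there exists a bounded function f ∈ K_α(X) taking values in [0,1] such that A = f⁻¹(0). -/

import Mathlib

open Set

universe u v

/-- `A` is functionally open in `X`: `A = f⁻¹((0,1])` for some continuous `f : X → [0,1]`. -/
def FunctionallyOpen (X : Type u) [TopologicalSpace X] (A : Set X) : Prop :=
  ∃ f : X → ℝ, Continuous f ∧ (∀ x, f x ∈ Set.Icc (0:ℝ) 1) ∧ A = f ⁻¹' (Set.Ioc 0 1)

/-- `A` is functionally closed in `X`: `A = f⁻¹(0)` for some continuous `f : X → [0,1]`. -/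
def FunctionallyClosed (X : Type u) [TopologicalSpace X] (A : Set X) : Prop :=
  ∃ f : X → ℝ, Continuous f ∧ (∀ x, f x ∈ Set.Icc (0:ℝ) 1) ∧ A = f ⁻¹' {0}

mutual
/-- The `α`'th functionally additive class in `X`. -/
inductive FunAdd (X : Type u) [TopologicalSpace X] : Ordinal.{0} → Set X → Prop where
  | base (A : Set X) : FunctionallyOpen X A → FunAdd X 0 A
  | union (α : Ordinal.{0}) (hα : α ≠ 0) (β : ℕ → Ordinal.{0}) (hβ : ∀ n, β n < α)
      (s : ℕ → Set X) (hs : ∀ n, FunMul X (β n) (s n)) : FunAdd X α (⋃ n, s n)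

/-- The `α`'th functionally multiplicative class in `X`. -/
inductive FunMul (X : Type u) [TopologicalSpace X] : Ordinal.{0} → Set X → Prop where
  | base (A : Set X) : FunctionallyClosed X A → FunMul X 0 A
  | inter (α : Ordinal.{0}) (hα : α ≠ 0) (β : ℕ → Ordinal.{0}) (hβ : ∀ n, β n < α)
      (s : ℕ → Set X) (hs : ∀ n, FunAdd X (β n) (s n)) : FunMul X α (⋂ n, s n)
end

mutual
/-- The `α`'th (ordinary) additive Borel class in `X`. -/
inductive BorelAdd (X : Type u) [TopologicalSpace X] : Ordinal.{0} → Set X → Prop where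
  | base (A : Set X) : IsOpen A → BorelAdd X 0 A
  | union (α : Ordinal.{0}) (hα : α ≠ 0) (β : ℕ → Ordinal.{0}) (hβ : ∀ n, β n < α)
      (s : ℕ → Set X) (hs : ∀ n, BorelMul X (β n) (s n)) : BorelAdd X α (⋃ n, s n)

/-- The `α`'th (ordinary) multiplicative Borel class in `X`. -/
inductive BorelMul (X : Type u) [TopologicalSpace X] : Ordinal.{0} → Set X → Prop where
  | base (A : Set X) : IsClosed A → BorelMul X 0 A
  | inter (α : Ordinal.{0}) (hα : α ≠ 0) (β : ℕ → Ordinal.{0}) (hβ : ∀ n, β n < α)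
      (s : ℕ → Set X) (hs : ∀ n, BorelAdd X (β n) (s n)) : BorelMul X α (⋂ n, s n)
end

/-- A set is functionally ambiguous of class `α` if it belongs to both the `α`'th functionally
additive and the `α`'th functionally multiplicative class. -/
def FunAmbiguous (X : Type u) [TopologicalSpace X] (α : Ordinal.{0}) (A : Set X) : Prop :=
  FunAdd X α A ∧ FunMul X α A

/-- `f ∈ K_α(X,Y)`: for `α = 0` continuity, for `α > 0` preimages of open sets belong to
the `α`'th functionally additive class. -/
def KClass {X : Type u} {Y : Type v} [TopologicalSpace X] [TopologicalSpace Y]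
    (α : Ordinal.{0}) (f : X → Y) : Prop :=
  (α = 0 → Continuous f) ∧ (α ≠ 0 → ∀ V : Set Y, IsOpen V → FunAdd X α (f ⁻¹' V))

/-- `A` and `B` are `α`-separated in `X`. -/
def AlphaSeparated {X : Type u} [TopologicalSpace X] (α : Ordinal.{0}) (A B : Set X) : Prop :=
  ∃ f : X → ℝ, KClass α f ∧ A ⊆ f ⁻¹' {0} ∧ B ⊆ f ⁻¹' {1}

/-- `X` is an `α`-separated space: any two disjoint sets of the `α`'th (ordinary)
multiplicative class are `α`-separated. -/
def AlphaSeparatedSpace (X : Type u) [TopologicalSpace X] (α : Ordinal.{0}) : Prop :=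
  ∀ A B : Set X, BorelMul X α A → BorelMul X α B → Disjoint A B → AlphaSeparated α A B

/-- `E` is `α`-embedded in `X`. -/
def AlphaEmbedded {X : Type u} [TopologicalSpace X] (α : Ordinal.{0}) (E : Set X) : Prop :=
  (∀ A : Set ↥E, FunAdd ↥E α A → ∃ B : Set X, FunAdd X α B ∧ Subtype.val '' A = B ∩ E) ∧
  (∀ A : Set ↥E, FunMul ↥E α A → ∃ B : Set X, FunMul X α B ∧ Subtype.val '' A = B ∩ E)

/-- `E` is ambiguously `α`-embedded in `X`. -/
def AmbiguouslyEmbedded {X : Type u} [TopologicalSpace X] (α : Ordinal.{0}) (E : Set X) : Prop :=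
  ∀ A : Set ↥E, FunAmbiguous ↥E α A →
    ∃ B : Set X, FunAmbiguous X α B ∧ Subtype.val '' A = B ∩ E

/-- The first uncountable ordinal. -/
noncomputable def omega1 : Ordinal.{0} := (Cardinal.aleph 1).ord

/-- `A` is an `F_σ`-set: a countable union of closed sets. -/
def IsFSigma {X : Type u} [TopologicalSpace X] (A : Set X) : Prop :=
  ∃ F : ℕ → Set X, (∀ n, IsClosed (F n)) ∧ A = ⋃ n, F n

/-- A space has a countable π-base. -/
def CountablePiBase (Z : Type v) [TopologicalSpace Z] : Prop :=
  ∃ 𝒰 : Set (Set Z), 𝒰.Countable ∧ (∀ U ∈ 𝒰, IsOpen U ∧ U.Nonempty) ∧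
    ∀ V : Set Z, IsOpen V → V.Nonempty → ∃ U ∈ 𝒰, U ⊆ V

section helpers
variable {X : Type u} [TopologicalSpace X]

theorem aux_fo_compl {A : Set X} (h : FunctionallyOpen X A) : FunctionallyClosed X Aᶜ := by
  obtain ⟨f, hc, hf, rfl⟩ := h
  refine ⟨f, hc, hf, ?_⟩
  ext x
  have := hf x
  simp only [mem_compl_iff, mem_preimage, mem_Ioc, mem_singleton_iff, mem_Icc] at *
  constructor
  · intro h
    by_contra h0
    exact h ⟨lt_of_le_of_ne this.1 (Ne.symm h0), this.2⟩
  · intro h h'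
    linarith [h'.1]

theorem aux_fc_compl {A : Set X} (h : FunctionallyClosed X A) : FunctionallyOpen X Aᶜ := by
  obtain ⟨f, hc, hf, rfl⟩ := h
  refine ⟨f, hc, hf, ?_⟩
  ext x
  have := hf x
  simp only [mem_compl_iff, mem_preimage, mem_Ioc, mem_singleton_iff, mem_Icc] at *
  constructor
  · intro h0
    exact ⟨lt_of_le_of_ne this.1 (Ne.symm h0), this.2⟩
  · intro h h'
    linarith [h.1]

theorem aux_compl (α : Ordinal.{0}) : ∀ A : Set X,
    (FunAdd X α A → FunMul X α Aᶜ) ∧ (FunMul X α A → FunAdd X α Aᶜ) := by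
  induction α using WellFoundedLT.induction with
  | ind α ih =>
    intro A
    constructor
    · intro h
      cases h with
      | base _ h => exact FunMul.base _ (aux_fo_compl h)
      | union _ hα β hβ s hs =>
        rw [compl_iUnion]
        exact FunMul.inter _ hα β hβ _ (fun n => (ih _ (hβ n) _).2 (hs n))
    · intro h
      cases h with
      | base _ h => exact FunAdd.base _ (aux_fc_compl h)
      | inter _ hα β hβ s hs =>
        rw [compl_iInter]
        exact FunAdd.union _ hα β hβ _ (fun n => (ih _ (hβ n) _).1 (hs n))

theorem aux_fo_union {A : Set X} (h : FunctionallyOpen X A) :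
    ∃ s : ℕ → Set X, (∀ n, FunctionallyClosed X (s n)) ∧ A = ⋃ n, s n := by
  obtain ⟨f, hc, hf, rfl⟩ := h
  refine ⟨fun n => {x | 1 / ((n:ℝ) + 1) ≤ f x}, fun n => ?_, ?_⟩
  · have hn : 1 / ((n:ℝ) + 1) ≤ 1 := by
      rw [div_le_one (by positivity)]
      linarith [(Nat.cast_nonneg n : (0:ℝ) ≤ n)]
    refine ⟨fun x => max 0 (1 / ((n:ℝ) + 1) - f x), by fun_prop, fun x => ⟨le_max_left _ _, ?_⟩, ?_⟩
    · exact max_le zero_le_one (by linarith [(hf x).1])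
    · ext x
      simp only [mem_ofPred_eq, mem_preimage, mem_singleton_iff, max_eq_left_iff, sub_nonpos]
  · ext x
    simp only [mem_preimage, mem_Ioc, mem_iUnion, mem_ofPred_eq]
    constructor
    · rintro ⟨h, -⟩
      obtain ⟨n, hn⟩ := exists_nat_one_div_lt h
      exact ⟨n, hn.le⟩
    · rintro ⟨n, hn⟩
      exact ⟨lt_of_lt_of_le (by positivity) hn, (hf x).2⟩

theorem aux_add_mono {α β : Ordinal.{0}} (hβ : β ≤ α) {A : Set X} (h : FunAdd X β A) :
    FunAdd X α A := by
  rcases hβ.eq_or_lt with rfl | hlt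
  · exact h
  have hα : α ≠ 0 := (lt_of_le_of_lt (zero_le) hlt).ne'
  cases h with
  | base _ h =>
    obtain ⟨s, hs, rfl⟩ := aux_fo_union h
    exact FunAdd.union _ hα (fun _ => 0) (fun _ => hlt) s (fun n => FunMul.base _ (hs n))
  | union _ hb γ hγ s hs =>
    exact FunAdd.union _ hα γ (fun n => (hγ n).trans hlt) s hs

theorem aux_mul_mono {α β : Ordinal.{0}} (hβ : β ≤ α) {A : Set X} (h : FunMul X β A) :
    FunMul X α A := by
  have := (aux_compl α _).1 (aux_add_mono hβ ((aux_compl β _).2 h))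
  rwa [compl_compl] at this

theorem aux_mul_add {α β : Ordinal.{0}} (hβ : β < α) {A : Set X} (h : FunMul X β A) :
    FunAdd X α A := by
  have hα : α ≠ 0 := (lt_of_le_of_lt (zero_le) hβ).ne'
  have := FunAdd.union (X := X) α hα (fun _ => β) (fun _ => hβ) (fun _ => A) (fun _ => h)
  rwa [iUnion_const] at this

theorem aux_add_iUnion {α : Ordinal.{0}} (hα : α ≠ 0) {s : ℕ → Set X}
    (h : ∀ n, FunAdd X α (s n)) : FunAdd X α (⋃ n, s n) := by
  have key : ∀ n, ∃ (β : ℕ → Ordinal.{0}) (t : ℕ → Set X), (∀ m, β m < α) ∧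
      (∀ m, FunMul X (β m) (t m)) ∧ s n = ⋃ m, t m := by
    intro n
    have := h n
    generalize s n = B at this
    cases this with
    | base _ h => exact absurd rfl hα
    | union _ _ β hβ t ht => exact ⟨β, t, hβ, ht, rfl⟩
  choose β t hβ ht hs using key
  have := FunAdd.union (X := X) α hα (fun k => β k.unpair.1 k.unpair.2) (fun k => hβ _ _)
    (fun k => t k.unpair.1 k.unpair.2) (fun k => ht _ _)
  rw [iUnion_unpair (fun i j => t i j)] at this
  simpa only [hs] using this

theorem aux_mul_iInter {α : Ordinal.{0}} (hα : α ≠ 0) {s : ℕ → Set X}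
    (h : ∀ n, FunMul X α (s n)) : FunMul X α (⋂ n, s n) := by
  have := (aux_compl α _).1 (aux_add_iUnion hα (fun n => (aux_compl α _).2 (h n)))
  simpa only [compl_iUnion, compl_compl] using this

theorem aux_mul_inter {α : Ordinal.{0}} {A B : Set X} (hA : FunMul X α A) (hB : FunMul X α B) :
    FunMul X α (A ∩ B) := by
  by_cases hα : α = 0
  · subst hα
    cases hA with
    | inter _ h => exact absurd rfl h
    | base _ hA =>
    cases hB with
    | inter _ h => exact absurd rfl h
    | base _ hB =>
    obtain ⟨f, hc, hf, rfl⟩ := hA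
    obtain ⟨g, hc', hg, rfl⟩ := hB
    refine FunMul.base _ ⟨fun x => max (f x) (g x), hc.max hc',
      fun x => ⟨(hf x).1.trans (le_max_left _ _), max_le (hf x).2 (hg x).2⟩, ?_⟩
    ext x
    simp only [mem_inter_iff, mem_preimage, mem_singleton_iff]
    constructor
    · rintro ⟨h, h'⟩
      simp [h, h']
    · intro h
      exact ⟨le_antisymm (h ▸ le_max_left _ _) (hf x).1, le_antisymm (h ▸ le_max_right _ _) (hg x).1⟩
  · have := aux_mul_iInter (X := X) hα (s := fun n => if n = 0 then A else B)
      (fun n => by split_ifs <;> assumption)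
    convert this using 1
    ext x
    simp only [mem_inter_iff, mem_iInter]
    constructor
    · rintro ⟨h, h'⟩ n
      split_ifs <;> assumption
    · intro h
      exact ⟨by simpa using h 0, by simpa using h 1⟩

theorem aux_add_inter {α : Ordinal.{0}} (hα : α ≠ 0) {A B : Set X}
    (hA : FunAdd X α A) (hB : FunAdd X α B) : FunAdd X α (A ∩ B) := by
  cases hA with
  | base _ h => exact absurd rfl hα
  | union _ _ β hβ s hs =>
  cases hB with
  | base _ h => exact absurd rfl hα
  | union _ _ γ hγ t ht =>
  rw [iUnion_inter]
  refine aux_add_iUnion hα fun n => ?_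
  rw [inter_iUnion]
  refine aux_add_iUnion hα fun m => ?_
  exact aux_mul_add (max_lt (hβ n) (hγ m))
    (aux_mul_inter (aux_mul_mono (le_max_left _ _) (hs n)) (aux_mul_mono (le_max_right _ _) (ht m)))

theorem aux_add_univ (α : Ordinal.{0}) : FunAdd X α univ :=
  aux_add_mono zero_le (FunAdd.base _ ⟨fun _ => 1, continuous_const, by simp, by simp⟩)

theorem aux_add_empty (α : Ordinal.{0}) : FunAdd X α ∅ :=
  aux_add_mono zero_le (FunAdd.base _ ⟨fun _ => 0, continuous_const, by simp, by simp⟩)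

theorem aux_cantor {α : Ordinal.{0}} (hα : α ≠ 0) (g : X → ℕ → Bool)
    (hg : ∀ n b, FunAdd X α {x | g x n = b}) (W : Set (ℕ → Bool)) (hW : IsOpen W) :
    FunAdd X α (g ⁻¹' W) := by
  have hcyl : ∀ (y : ℕ → Bool) n, FunAdd X α {x | ∀ i < n, g x i = y i} := by
    intro y n
    induction n with
    | zero => simpa using aux_add_univ α
    | succ n ih =>
      convert aux_add_inter hα ih (hg n (y n)) using 1
      ext x
      simp only [mem_ofPred_eq, mem_inter_iff, Nat.forall_lt_succ_right]
  obtain ⟨S, hS, rfl⟩ := (PiNat.isTopologicalBasis_cylinders (fun _ : ℕ => Bool)).open_eq_sUnion hW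
  obtain ⟨T, hTc, hTS, hTe⟩ := TopologicalSpace.isOpen_sUnion_countable S
    (fun s hs => (PiNat.isTopologicalBasis_cylinders (fun _ : ℕ => Bool)).isOpen (hS hs))
  rw [← hTe]
  rcases T.eq_empty_or_nonempty with rfl | hne
  · simpa using aux_add_empty α
  obtain ⟨u, rfl⟩ := hTc.exists_eq_range hne
  rw [sUnion_range, preimage_iUnion]
  refine aux_add_iUnion hα fun n => ?_
  obtain ⟨y, m, hu⟩ := hS (hTS (mem_range_self n))
  rw [hu]
  exact hcyl y m

end helpers

/-- every set of the `α`'th functionally multiplicative class is the zero set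
of a bounded `K_α`-function with values in `[0,1]`. -/
theorem stmt2 {X : Type u} [TopologicalSpace X] (α : Ordinal.{0}) (hα : α < omega1)
    (A : Set X) (hA : FunMul X α A) :
    ∃ f : X → ℝ, KClass α f ∧ (∀ x, f x ∈ Set.Icc (0:ℝ) 1) ∧ A = f ⁻¹' {0} := by
  classical
  cases hA with
  | base _ h =>
    obtain ⟨f, hc, hf, rfl⟩ := h
    exact ⟨f, ⟨fun _ => hc, fun h => absurd rfl h⟩, hf, rfl⟩
  | inter _ h0 β hβ s hs =>
    letI : MetricSpace (ℕ → Bool) := TopologicalSpace.metrizableSpaceMetric (ℕ → Bool)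
    let g : X → ℕ → Bool := fun x n => decide (x ∈ s n)
    let h : (ℕ → Bool) → ℝ := fun b => min 1 (dist b (fun _ => true))
    have hh : Continuous h := continuous_const.min (continuous_id.dist continuous_const)
    refine ⟨fun x => h (g x), ⟨fun h => absurd h h0, fun _ V hV => ?_⟩, fun x => ?_, ?_⟩
    · refine aux_cantor h0 g ?_ (h ⁻¹' V) (hV.preimage hh)
      intro n b
      cases b with
      | true =>
        convert aux_add_mono (hβ n).le (hs n) using 1
        ext x
        simp [g]
      | false =>
        convert aux_mul_add (hβ n) ((aux_compl _ _).1 (hs n)) using 1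
        ext x
        simp [g]
    · exact ⟨le_min zero_le_one dist_nonneg, min_le_left _ _⟩
    · ext x
      have e : h (g x) = 0 ↔ g x = fun _ => true := by
        rw [← dist_eq_zero (x := g x)]
        dsimp only [h]
        constructor
        · intro h'
          rcases min_choice (1:ℝ) (dist (g x) (fun _ => true)) with h1 | h1
          · rw [h1] at h'
            exact absurd h' one_ne_zero
          · rw [← h1, h']
        · intro h'
          rw [h']
          simp
      rw [mem_preimage, mem_singleton_iff, e, funext_iff]
      simp [g]
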